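/- Let f : S¹ → S¹ be a homeomorphism of the circle whose set of non-wandering points is finite (and nonempty). Then for every integer k ≥ 1, the polynomial entropy of the induced map f^{*k} on the k-fold symmetric product (S¹)^{*k} equals k. -/

import Mathlib

open Filter Topology TopologicalSpace Set
open scoped ENNReal

/-- The dynamic distance `d_n^f(x,y) = max_{0 ≤ k ≤ n-1} d(f^k x, f^k y)`. -/
noncomputable def dynDist {X : Type*} [MetricSpace X] (f : X → X) (n : ℕ) (x y : X) : ℝ :=
  ((Finset.range n).sup fun k => nndist (f^[k] x) (f^[k] y) : NNReal)

/-- A finite set `E` is `(n,ε)`-separated for `f`. -/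
def IsDynSeparated {X : Type*} [MetricSpace X] (f : X → X) (n : ℕ) (ε : ℝ) (E : Finset X) :
    Prop :=
  ∀ x ∈ E, ∀ y ∈ E, x ≠ y → ε ≤ dynDist f n x y

/-- `S(n,ε;Y)`: the maximal cardinality of an `(n,ε)`-separated subset of `Y`. -/
noncomputable def maxSep {X : Type*} [MetricSpace X] (f : X → X) (Y : Set X) (n : ℕ) (ε : ℝ) :
    ℕ :=
  sSup {m : ℕ | ∃ E : Finset X, ↑E ⊆ Y ∧ E.card = m ∧ IsDynSeparated f n ε E}

/-- The polynomial entropy `h_pol(f;Y)`.  Since `ε ↦ S(n,ε;Y)` is nonincreasing, the limit as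
`ε → 0` of the `limsup` coincides with the supremum over `ε > 0`. -/
noncomputable def polEnt {X : Type*} [MetricSpace X] (f : X → X) (Y : Set X) : ℝ≥0∞ :=
  ⨆ (ε : ℝ) (_ : 0 < ε),
    Filter.atTop.limsup fun n : ℕ =>
      ENNReal.ofReal (Real.log (maxSep f Y n ε) / Real.log n)

/-- The set of non-wandering points of `f`. -/
def nonWandering {X : Type*} [TopologicalSpace X] (f : X → X) : Set X :=
  {p | ∀ U ∈ nhds p, ∃ n : ℕ, 1 ≤ n ∧ (f^[n] '' U ∩ U).Nonempty}

/-- The induced map `2^f` on the hyperspace of nonempty closed (= compact) subsets of a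
compact metric space. -/
noncomputable def induced2 {X : Type*} [TopologicalSpace X] (f : X → X) (hf : Continuous f) :
    NonemptyCompacts X → NonemptyCompacts X :=
  fun A => ⟨⟨f '' A, A.isCompact.image hf⟩, A.nonempty.image f⟩

/-- The hyperspace `C(X)` of subcontinua (nonempty closed connected subsets) of `X`. -/
abbrev Subcontinua (X : Type*) [TopologicalSpace X] :=
  {A : NonemptyCompacts X // IsConnected (A : Set X)}

/-- The induced map `C(f)` on the hyperspace of subcontinua. -/
noncomputable def inducedC {X : Type*} [TopologicalSpace X] (f : X → X) (hf : Continuous f) :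
    Subcontinua X → Subcontinua X :=
  fun A => ⟨induced2 f hf A.1, A.2.image f hf.continuousOn⟩

/-- The `k`-fold symmetric product `X^{*k}`: nonempty subsets of `X` with at most `k` points. -/
abbrev SymProd (X : Type*) [TopologicalSpace X] (k : ℕ) :=
  {A : NonemptyCompacts X // (A : Set X).Finite ∧ (A : Set X).ncard ≤ k}

/-- The induced map `f^{*k}` on the `k`-fold symmetric product. -/
noncomputable def inducedSym {X : Type*} [TopologicalSpace X] (f : X → X) (hf : Continuous f)
    (k : ℕ) : SymProd X k → SymProd X k :=
  fun A => ⟨induced2 f hf A.1, A.2.1.image f, le_trans (Set.ncard_image_le A.2.1) A.2.2⟩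

/-- Sets `U 0, …, U (L-1)` are mutually singular for `f`. -/
def MutuallySingularSets {X : Type*} [TopologicalSpace X] (f : X → X) {L : ℕ}
    (U : Fin L → Set X) : Prop :=
  ∀ M : ℕ, ∃ x : X, ∃ n : Fin L → ℕ, (∀ j, 1 ≤ n j ∧ f^[n j] x ∈ U j) ∧
    ∀ i j, i ≠ j → (M : ℤ) < |(n i : ℤ) - (n j : ℤ)|

/-- A finite set `S ⊆ X \ NW(f)` is singular: it consists of mutually singular points, i.e.
every family of respective neighbourhoods of its points is mutually singular. -/
def IsSingularSet {X : Type*} [TopologicalSpace X] (f : X → X) (S : Set X) : Prop :=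
  S.Finite ∧ (∀ x ∈ S, x ∉ nonWandering f) ∧
  ∀ (L : ℕ) (x : Fin L → X), Function.Injective x → Set.range x = S →
    ∀ U : Fin L → Set X, (∀ j, U j ∈ nhds (x j)) → MutuallySingularSets f U

/-- The set of codings of length-`n` orbit segments of points of `Y` relative to the family
`F`, where the letter `none` stands for `Y_∞ = Y \ ⋃ F`. -/
def codings {X : Type*} (f : X → X) {L : ℕ} (F : Fin L → Set X) (Y : Set X) (n : ℕ) :
    Set (Fin n → Option (Fin L)) :=
  {w | ∃ x ∈ Y, ∀ j : Fin n, match w j with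
    | some i => f^[(j : ℕ)] x ∈ F i
    | none => f^[(j : ℕ)] x ∈ Y \ ⋃ i, F i}

/-- The polynomial entropy of `f` on `Y` relative to the family `F`:
`limsup_n log #A_n(F;Y) / log n`. -/
noncomputable def polEntRel {X : Type*} (f : X → X) {L : ℕ} (F : Fin L → Set X) (Y : Set X) :
    ℝ≥0∞ :=
  Filter.atTop.limsup fun n : ℕ =>
    ENNReal.ofReal (Real.log ((codings f F Y n).ncard) / Real.log n)

/-- The circle is connected. -/
theorem circle_isConnected_univ : IsConnected (Set.univ : Set Circle) := by
  have hsurj : Function.Surjective Circle.exp := fun z => ⟨Complex.arg z, Circle.exp_arg z⟩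
  have : ConnectedSpace Circle :=
    { toPreconnectedSpace := ⟨by
        rw [← Set.image_univ_of_surjective hsurj]
        exact isPreconnected_univ.image _ Circle.exp.continuous.continuousOn⟩,
      toNonempty := ⟨1⟩ }
  exact isConnected_univ


theorem dynDist_le_iff {X : Type*} [MetricSpace X] {f : X → X} {n : ℕ} {x y : X} {r : ℝ}
    (hr : 0 ≤ r) : dynDist f n x y ≤ r ↔ ∀ j < n, dist (f^[j] x) (f^[j] y) ≤ r := by
  lift r to NNReal using hr
  simp only [dynDist, NNReal.coe_le_coe, Finset.sup_le_iff, Finset.mem_range, ← coe_nndist]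

theorem dist_iterate_le_dynDist {X : Type*} [MetricSpace X] (f : X → X) {n j : ℕ} (hj : j < n)
    (x y : X) : dist (f^[j] x) (f^[j] y) ≤ dynDist f n x y :=
  (dynDist_le_iff (NNReal.coe_nonneg _)).1 le_rfl j hj

theorem dynDist_self {X : Type*} [MetricSpace X] (f : X → X) (n : ℕ) (x : X) :
    dynDist f n x x = 0 := by
  simp [dynDist]

/-- A family of indexed points whose pairwise dynamic distances are at least `ε` bounds `maxSep`
from below, as soon as the cardinalities of separated sets are bounded. -/
theorem card_le_maxSep {X ι : Type*} [MetricSpace X] [Fintype ι] {f : X → X} {n : ℕ} {ε : ℝ}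
    (hε : 0 < ε) (φ : ι → X) (hφ : ∀ i j, i ≠ j → ε ≤ dynDist f n (φ i) (φ j)) {M : ℕ}
    (hM : ∀ E : Finset X, IsDynSeparated f n ε E → E.card ≤ M) :
    Fintype.card ι ≤ maxSep f univ n ε := by
  have hinj : Function.Injective φ := by
    intro i j hij
    by_contra hne
    have := hφ i j hne
    rw [hij, dynDist_self] at this
    linarith
  refine le_csSup ⟨M, ?_⟩ ⟨Finset.univ.map ⟨φ, hinj⟩, subset_univ _, by simp, ?_⟩
  · rintro m ⟨E, -, rfl, hE⟩
    exact hM E hE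
  · intro x hx y hy hxy
    obtain ⟨i, -, rfl⟩ := Finset.mem_map.1 hx
    obtain ⟨j, -, rfl⟩ := Finset.mem_map.1 hy
    exact hφ i j fun h => hxy (by rw [h])

theorem maxSep_le {X : Type*} [MetricSpace X] {f : X → X} {n : ℕ} {ε : ℝ} {M : ℕ}
    (hM : ∀ E : Finset X, IsDynSeparated f n ε E → E.card ≤ M) : maxSep f univ n ε ≤ M := by
  refine csSup_le ⟨0, ∅, by simp, by simp, by simp [IsDynSeparated]⟩ ?_
  rintro m ⟨E, -, rfl, hE⟩
  exact hM E hE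

theorem coe_iterate_inducedSym {X : Type*} [TopologicalSpace X] (f : X → X) (hf : Continuous f)
    (k j : ℕ) (A : SymProd X k) :
    ((((inducedSym f hf k)^[j] A : SymProd X k) : NonemptyCompacts X) : Set X)
      = f^[j] '' (A.1 : Set X) := by
  induction j with
  | zero => simp
  | succ j ih =>
    rw [Function.iterate_succ_apply', Function.iterate_succ', image_comp, ← ih]
    rfl

theorem SymProd.dist_eq {X : Type*} [MetricSpace X] {k : ℕ} (A B : SymProd X k) :
    dist A B = Metric.hausdorffDist (A.1 : Set X) (B.1 : Set X) := rfl

/-- If orbit segments of length `n` can be coded by `M` symbols so that points with the same code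
stay `δ`-close, then separated sets in the symmetric product have at most `M ^ k` elements. -/
theorem card_le_pow_of_coding {X : Type*} [MetricSpace X] (f : X → X) (hf : Continuous f)
    (k n M : ℕ) {δ ε : ℝ} (hδ : 0 ≤ δ) (hδε : δ < ε) (c : X → Fin M)
    (hc : ∀ x y, c x = c y → ∀ j < n, dist (f^[j] x) (f^[j] y) ≤ δ)
    (E : Finset (SymProd X k)) (hE : IsDynSeparated (inducedSym f hf k) n ε E) :
    E.card ≤ M ^ k := by
  have hg : ∀ A : SymProd X k, ∃ g : Fin k → Fin M, range g = c '' (A.1 : Set X) := by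
    intro A
    have hne : (c '' (A.1 : Set X)).Nonempty := A.1.nonempty.image c
    have : Nonempty (c '' (A.1 : Set X)) := hne.to_subtype
    have := (toFinite (c '' (A.1 : Set X))).fintype
    have hle : Fintype.card (c '' (A.1 : Set X)) ≤ Fintype.card (Fin k) := by
      rw [Fintype.card_fin, ← Nat.card_eq_fintype_card, Nat.card_coe_set_eq]
      exact (ncard_image_le A.2.1).trans A.2.2
    obtain ⟨e⟩ := Function.Embedding.nonempty_of_card_le hle
    refine ⟨fun i => (Function.invFun e i : c '' (A.1 : Set X)), ?_⟩
    rw [← Function.comp_def, range_comp, (Function.invFun_surjective e.injective).range_eq, image_univ,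
      Subtype.range_coe]
  choose g hg using hg
  have hinj : Set.InjOn g (E : Set (SymProd X k)) := by
    intro A hA B hB hAB
    by_contra hne
    have himg : c '' (A.1 : Set X) = c '' (B.1 : Set X) := by rw [← hg, ← hg, hAB]
    have hle : dynDist (inducedSym f hf k) n A B ≤ δ := by
      rw [dynDist_le_iff hδ]
      intro j hj
      rw [SymProd.dist_eq, coe_iterate_inducedSym, coe_iterate_inducedSym]
      refine Metric.hausdorffDist_le_of_mem_dist hδ ?_ ?_
      · rintro _ ⟨a, ha, rfl⟩
        obtain ⟨b, hb, hab⟩ := himg ▸ mem_image_of_mem c ha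
        exact ⟨_, mem_image_of_mem _ hb, hc a b hab.symm j hj⟩
      · rintro _ ⟨b, hb, rfl⟩
        obtain ⟨a, ha, hab⟩ := himg.symm ▸ mem_image_of_mem c hb
        exact ⟨_, mem_image_of_mem _ ha, hc b a hab.symm j hj⟩
    linarith [hE A hA B hB hne]
  calc E.card ≤ (Finset.univ : Finset (Fin k → Fin M)).card :=
        Finset.card_le_card_of_injOn g (fun _ _ => Finset.mem_univ _) hinj
    _ = M ^ k := by simp

/-- The circle can be cut at finitely many points into pieces of arbitrarily small diameter. -/
theorem Circle.exists_finset_dist_le {δ : ℝ} (hδ : 0 < δ) :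
    ∃ P : Finset Circle, ∀ C : Set Circle, IsPreconnected C → Disjoint C (P : Set Circle) →
      ∀ x ∈ C, ∀ y ∈ C, dist x y ≤ δ := by
  have huc := isCompact_Icc (a := -Real.pi) (b := Real.pi) |>.uniformContinuousOn_of_continuous
    Circle.exp.continuous.continuousOn
  obtain ⟨η, hη, hdist⟩ := Metric.uniformContinuousOn_iff_le.1 huc δ hδ
  obtain ⟨N, hN⟩ := exists_nat_gt (Real.pi / η)
  have hπ := Real.pi_pos
  have hN0 : (0 : ℝ) < N := lt_trans (by positivity) hN
  have hstep : Real.pi / N < η := by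
    rw [div_lt_iff₀ hη] at hN
    rw [div_lt_iff₀ hN0]
    linarith
  set t : ℤ → ℝ := fun j => j * (Real.pi / N) with ht
  classical
  refine ⟨(Finset.Icc (-N : ℤ) N).image fun j => Circle.exp (t j), fun C hC hCP => ?_⟩
  have hmem : ∀ j : ℤ, -(N : ℤ) ≤ j → j ≤ N → Circle.exp (t j) ∉ C := by
    intro j h1 h2 hjC
    refine Set.disjoint_left.1 hCP hjC ?_
    simp only [Finset.coe_image, Finset.coe_Icc]
    exact ⟨j, ⟨h1, h2⟩, rfl⟩
  have hslit : ∀ z ∈ C, (z : ℂ) ∈ Complex.slitPlane := by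
    intro z hz
    rw [Complex.mem_slitPlane_iff_arg]
    refine ⟨fun harg => ?_, z.coe_ne_zero⟩
    refine hmem N (by omega) le_rfl ?_
    have : t N = Complex.arg z := by
      rw [harg]; simp only [ht]; push_cast; field_simp
    rwa [this, Circle.exp_arg]
  have hcont : ContinuousOn (fun z : Circle => Complex.arg z) C := fun z hz =>
    ((Complex.continuousAt_arg (hslit z hz)).comp
      (continuous_subtype_val.continuousAt)).continuousWithinAt
  have hord := (hC.image _ hcont).ordConnected
  have key : ∀ x ∈ C, ∀ y ∈ C, Complex.arg x ≤ Complex.arg y → dist x y ≤ δ := by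
    intro x hx y hy hxy
    have hab : Complex.arg y - Complex.arg x ≤ η := by
      by_contra! hlt
      set s := Real.pi / N with hs
      have hs0 : 0 < s := by positivity
      have hNs : N * s = Real.pi := by rw [hs]; field_simp
      set j : ℤ := ⌊Complex.arg x / s⌋ + 1 with hj
      have h1 : Complex.arg x < j * s := by
        have := Int.lt_floor_add_one (Complex.arg x / s)
        rw [div_lt_iff₀ hs0] at this
        rw [hj]; push_cast; exact this
      have h2 : (j : ℝ) * s ≤ Complex.arg y := by
        have := Int.floor_le (Complex.arg x / s)
        rw [le_div_iff₀ hs0] at this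
        rw [hj]; push_cast; linarith
      obtain ⟨z, hz, hzj⟩ := hord.out (mem_image_of_mem _ hx) (mem_image_of_mem _ hy) ⟨h1.le, h2⟩
      have hb1 : -(N : ℝ) < j := by
        have := Complex.neg_pi_lt_arg x
        by_contra! h
        nlinarith
      have hb2 : (j : ℝ) ≤ N := by
        have := Complex.arg_le_pi y
        by_contra! h
        nlinarith
      refine hmem j (by exact_mod_cast hb1.le) (by exact_mod_cast hb2) ?_
      have : t j = Complex.arg z := hzj.symm
      rwa [this, Circle.exp_arg]
    have := hdist (Complex.arg x) ⟨(Complex.neg_pi_lt_arg _).le, Complex.arg_le_pi _⟩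
      (Complex.arg y) ⟨(Complex.neg_pi_lt_arg _).le, Complex.arg_le_pi _⟩ (by
        rw [dist_comm, Real.dist_eq, abs_of_nonneg (by linarith)]; exact hab)
    rwa [Circle.exp_arg, Circle.exp_arg] at this
  intro x hx y hy
  rcases le_total (Complex.arg x) (Complex.arg y) with h | h
  · exact key x hx y hy h
  · rw [dist_comm]; exact key y hy x hx h

/-- A finite subset of a linear order cuts it into at most `2 * Q.card + 1` classes. -/
theorem Finset.exists_coding_linearOrder {α : Type*} [LinearOrder α] (Q : Finset α) {m : ℕ}
    (hm : Q.card ≤ m) : ∃ c : α → Fin (2 * m + 1), ∀ a b, a < b → c a = c b →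
      ∀ q ∈ Q, q ∉ Set.Icc a b := by
  have h1 := fun a => Finset.card_filter_le Q (· < a)
  have h2 := fun a => Finset.card_filter_le Q (· ≤ a)
  refine ⟨fun a => ⟨(Q.filter (· < a)).card + (Q.filter (· ≤ a)).card, ?_⟩, ?_⟩
  · have := h1 a
    have := h2 a
    omega
  · intro a b hab hc q hq hqab
    simp only [Fin.mk.injEq] at hc
    have s1 : Q.filter (· < a) ⊆ Q.filter (· < b) :=
      Finset.monotone_filter_right _ fun x _ hx => hx.trans hab
    have s2 : Q.filter (· ≤ a) ⊆ Q.filter (· ≤ b) :=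
      Finset.monotone_filter_right _ fun x _ hx => hx.trans hab.le
    have c1 := Finset.card_le_card s1
    have c2 := Finset.card_le_card s2
    have e1 := Finset.eq_of_subset_of_card_le s1 (by omega)
    have e2 := Finset.eq_of_subset_of_card_le s2 (by omega)
    rcases hqab.1.eq_or_lt with rfl | h
    · have : a ∈ Q.filter (· < a) := e1 ▸ Finset.mem_filter.2 ⟨hq, hab⟩
      exact lt_irrefl _ (Finset.mem_filter.1 this).2
    · have : q ∈ Q.filter (· ≤ a) := e2 ▸ Finset.mem_filter.2 ⟨hq, hqab.2⟩
      exact absurd (Finset.mem_filter.1 this).2 (not_le.2 h)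

/-- Orbit segments of a circle homeomorphism admit codings of linear complexity. -/
theorem Circle.exists_coding (f : Circle ≃ₜ Circle) {δ : ℝ} (hδ : 0 < δ) :
    ∃ N : ℕ, ∀ n : ℕ, ∃ c : Circle → Fin (2 * (n * N) + 1),
      ∀ x y, c x = c y → ∀ j < n, dist (f^[j] x) (f^[j] y) ≤ δ := by
  classical
  obtain ⟨P, hP⟩ := Circle.exists_finset_dist_le hδ
  refine ⟨P.card, fun n => ?_⟩
  let Q : Finset ℝ := (Finset.range n ×ˢ P).image fun p => Complex.arg (f.symm^[p.1] p.2)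
  have hQ : Q.card ≤ n * P.card := by
    refine Finset.card_image_le.trans ?_
    simp
  obtain ⟨c, hc⟩ := Q.exists_coding_linearOrder hQ
  have key : ∀ x y : Circle, Complex.arg x < Complex.arg y →
      c (Complex.arg x) = c (Complex.arg y) → ∀ j < n, dist (f^[j] x) (f^[j] y) ≤ δ := by
    intro x y hxy hcxy j hj
    let C : Set Circle := (fun s => f^[j] (Circle.exp s)) '' Icc (Complex.arg x) (Complex.arg y)
    have hC : IsPreconnected C := isPreconnected_Icc.image _
      ((f.continuous.iterate j).comp Circle.exp.continuous).continuousOn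
    refine hP C hC ?_ _ ⟨_, left_mem_Icc.2 hxy.le, by simp only [Circle.exp_arg]⟩
      _ ⟨_, right_mem_Icc.2 hxy.le, by simp only [Circle.exp_arg]⟩
    rw [Set.disjoint_left]
    rintro _ ⟨s, hs, rfl⟩ hp
    refine hc _ _ hxy hcxy s ?_ hs
    refine Finset.mem_image.2 ⟨(j, f^[j] (Circle.exp s)),
      Finset.mem_product.2 ⟨Finset.mem_range.2 hj, hp⟩, ?_⟩
    have hinv : Function.LeftInverse f.symm^[j] f^[j] :=
      Function.LeftInverse.iterate f.left_inv j
    dsimp only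
    rw [hinv]
    exact Circle.arg_exp ((Complex.neg_pi_lt_arg x).trans_le hs.1)
      (hs.2.trans (Complex.arg_le_pi y))
  refine ⟨fun x => c (Complex.arg x), fun x y hxy j hj => ?_⟩
  rcases lt_trichotomy (Complex.arg x) (Complex.arg y) with h | h | h
  · exact key x y h hxy j hj
  · rw [Circle.injective_arg h, dist_self]
    exact hδ.le
  · rw [dist_comm]
    exact key y x h hxy.symm j hj

/-- Distinct points of the orbit of a wandering point of a homeomorphism do not come back near
that point. -/
theorem exists_forall_le_dist_of_notMem_nonWandering {X : Type*} [MetricSpace X] (f : X ≃ₜ X)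
    {x : X} (hx : x ∉ nonWandering f) :
    ∃ ε > 0, ∀ i j : ℕ, i ≠ j → ε ≤ dist x (f^[i] (f.symm^[j] x)) := by
  simp only [nonWandering, mem_ofPred_eq, not_forall, not_exists, not_and] at hx
  obtain ⟨U, hU, hn⟩ := hx
  obtain ⟨ε, hε, hball⟩ := Metric.mem_nhds_iff.1 hU
  refine ⟨ε, hε, fun i j hij => ?_⟩
  by_contra! hlt
  have hmem : f^[i] (f.symm^[j] x) ∈ U := hball (by rwa [Metric.mem_ball'])
  have hxU : x ∈ U := mem_of_mem_nhds hU
  have hinv : ∀ m, Function.LeftInverse f^[m] f.symm^[m] := fun m =>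
    Function.LeftInverse.iterate f.right_inv m
  rcases lt_or_gt_of_ne hij with h | h
  · refine hn (j - i) (by omega) ⟨x, ⟨_, hmem, ?_⟩, hxU⟩
    rw [← Function.iterate_add_apply, Nat.sub_add_cancel h.le, hinv j]
  · refine hn (i - j) (by omega) ⟨_, ⟨x, hxU, rfl⟩, ?_⟩
    have : i = (i - j) + j := by omega
    rw [this, Function.iterate_add_apply, hinv j] at hmem
    exact hmem

/-- Finite sets of backward iterates of a wandering point are dynamically separated in the
symmetric product. -/
theorem exists_separated_family {X : Type*} [MetricSpace X] (f : X ≃ₜ X) {x : X}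
    (hx : x ∉ nonWandering f) {k : ℕ} (hk : 1 ≤ k) :
    ∃ ε > 0, ∀ n : ℕ, ∃ φ : Finset.powersetCard k (Finset.range n) → SymProd X k,
      ∀ A B, A ≠ B → ε ≤ dynDist (inducedSym f f.continuous k) n (φ A) (φ B) := by
  obtain ⟨ε, hε, hd⟩ := exists_forall_le_dist_of_notMem_nonWandering f hx
  refine ⟨ε, hε, fun n => ?_⟩
  let g : ℕ → X := fun i => f.symm^[i] x
  have hcard : ∀ A : Finset.powersetCard k (Finset.range n), A.1.card = k := fun A =>
    (Finset.mem_powersetCard.1 A.2).2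
  have hfin : ∀ A : Finset ℕ, (g '' (A : Set ℕ)).Finite := fun A => A.finite_toSet.image g
  let φ : Finset.powersetCard k (Finset.range n) → SymProd X k := fun A =>
    ⟨⟨⟨g '' (A.1 : Set ℕ), (hfin A.1).isCompact⟩, by
      refine Set.Nonempty.image g (Finset.coe_nonempty.2 (Finset.card_pos.1 ?_))
      rw [hcard A]; omega⟩, hfin A.1, by
      refine (ncard_image_le A.1.finite_toSet).trans ?_
      rw [ncard_coe_finset, hcard A]⟩
  refine ⟨φ, fun A B hAB => ?_⟩
  obtain ⟨i, hiA, hiB⟩ : ∃ i ∈ A.1, i ∉ B.1 := by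
    by_contra! hsub
    exact hAB (Subtype.ext (Finset.eq_of_subset_of_card_le hsub (by rw [hcard, hcard])))
  have hin : i < n := Finset.mem_range.1 ((Finset.mem_powersetCard.1 A.2).1 hiA)
  refine le_trans ?_ (dist_iterate_le_dynDist _ hin _ _)
  by_contra! hlt
  have hne : Metric.hausdorffEDist
      (((inducedSym f f.continuous k)^[i] (φ A)).1 : Set X)
      (((inducedSym f f.continuous k)^[i] (φ B)).1 : Set X) ≠ ⊤ :=
    Metric.hausdorffEDist_ne_top_of_nonempty_of_bounded (NonemptyCompacts.nonempty _)
      (NonemptyCompacts.nonempty _) (NonemptyCompacts.isCompact _).isBounded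
      (NonemptyCompacts.isCompact _).isBounded
  have hxA : x ∈ (((inducedSym f f.continuous k)^[i] (φ A)).1 : Set X) := by
    rw [coe_iterate_inducedSym]
    exact ⟨g i, ⟨i, hiA, rfl⟩, Function.LeftInverse.iterate f.right_inv i x⟩
  obtain ⟨y, hy, hxy⟩ := Metric.exists_dist_lt_of_hausdorffDist_lt hxA hlt hne
  rw [coe_iterate_inducedSym] at hy
  obtain ⟨_, ⟨j, hjB, rfl⟩, rfl⟩ := hy
  have hij : i ≠ j := fun h => hiB (h ▸ hjB)
  exact absurd (hd i j hij) (not_le.2 hxy)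

theorem tendsto_log_mul_pow_div_log (k : ℕ) {c : ℝ} (hc : 0 < c) :
    Tendsto (fun n : ℕ => ENNReal.ofReal (Real.log (c * (n : ℝ) ^ k) / Real.log n)) atTop
      (𝓝 (k : ℝ≥0∞)) := by
  rw [← ENNReal.ofReal_natCast]
  refine (ENNReal.continuous_ofReal.tendsto _).comp ?_
  have hlog : Tendsto (fun n : ℕ => Real.log n) atTop atTop :=
    Real.tendsto_log_atTop.comp tendsto_natCast_atTop_atTop
  have h : Tendsto (fun n : ℕ => Real.log c / Real.log n + k) atTop (𝓝 (0 + k)) :=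
    (hlog.const_div_atTop _).add tendsto_const_nhds
  rw [zero_add] at h
  refine h.congr' ?_
  filter_upwards [eventually_gt_atTop 1] with n hn
  have hn' : (1 : ℝ) < n := by exact_mod_cast hn
  have hl : Real.log n ≠ 0 := (Real.log_pos hn').ne'
  rw [Real.log_mul hc.ne' (by positivity), Real.log_pow]
  field_simp

/-- The binomial coefficient `n.choose k` grows at least like a multiple of `n ^ k`. -/
theorem Nat.mul_pow_le_choose {k n : ℕ} (hn : 2 * k ≤ n) :
    (1 / (2 ^ k * k.factorial) : ℝ) * (n : ℝ) ^ k ≤ n.choose k := by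
  refine le_trans ?_ (Nat.pow_le_choose k n)
  have h : (n : ℝ) / 2 ≤ ((n + 1 - k : ℕ) : ℝ) := by
    rw [div_le_iff₀ two_pos]
    norm_cast
    omega
  calc (1 / (2 ^ k * k.factorial) : ℝ) * (n : ℝ) ^ k = ((n : ℝ) / 2) ^ k / k.factorial := by
        rw [div_pow]; field_simp
    _ ≤ _ := by gcongr

-- STATEMENT 4
theorem stmt4 (f : Circle ≃ₜ Circle) (hNW : (nonWandering ⇑f).Finite)
    (hne : (nonWandering ⇑f).Nonempty) (k : ℕ) (hk : 1 ≤ k) :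
    polEnt (inducedSym ⇑f f.continuous k) Set.univ = (k : ℝ≥0∞) := by
  have hbound : ∀ ε : ℝ, 0 < ε → ∃ N : ℕ, ∀ n : ℕ, ∀ E : Finset (SymProd Circle k),
      IsDynSeparated (inducedSym f f.continuous k) n ε E → E.card ≤ (2 * (n * N) + 1) ^ k := by
    intro ε hε
    obtain ⟨N, hN⟩ := Circle.exists_coding f (half_pos hε)
    refine ⟨N, fun n E hE => ?_⟩
    obtain ⟨c, hc⟩ := hN n
    exact card_le_pow_of_coding f f.continuous k n _ (half_pos hε).le (half_lt_self hε) c hc E hE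
  refine le_antisymm (iSup₂_le fun ε hε => ?_) ?_
  · obtain ⟨N, hN⟩ := hbound ε hε
    rw [← (tendsto_log_mul_pow_div_log k (c := (2 * N + 1) ^ k) (by positivity)).limsup_eq]
    refine limsup_le_limsup ?_
    filter_upwards [eventually_gt_atTop 1] with n hn
    have hn' : (1 : ℝ) < n := by exact_mod_cast hn
    have hle : (maxSep (inducedSym f f.continuous k) univ n ε : ℝ)
        ≤ (2 * N + 1) ^ k * (n : ℝ) ^ k := by
      rw [← mul_pow]
      have : maxSep (inducedSym f f.continuous k) univ n ε ≤ ((2 * N + 1) * n) ^ k :=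
        (maxSep_le (hN n)).trans (Nat.pow_le_pow_left (by nlinarith) k)
      exact_mod_cast this
    refine ENNReal.ofReal_le_ofReal (div_le_div_of_nonneg_right ?_ (Real.log_pos hn').le)
    rcases (maxSep (inducedSym f f.continuous k) univ n ε).eq_zero_or_pos with h0 | h0
    · rw [h0, Nat.cast_zero, Real.log_zero]
      refine Real.log_nonneg ?_
      rw [← mul_pow]
      exact one_le_pow₀ (by nlinarith [(Nat.cast_nonneg N : (0 : ℝ) ≤ N)])
    · exact Real.log_le_log (by exact_mod_cast h0) hle
  · have : Infinite Circle := by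
      have := (Ioc_infinite (neg_lt_self Real.pi_pos)).to_subtype
      refine Infinite.of_injective (fun s : Ioc (-Real.pi) Real.pi => Circle.exp s) ?_
      intro s t hst
      exact Subtype.ext (Circle.invOn_arg_exp.1.injOn s.2 t.2 hst)
    obtain ⟨x, hx⟩ := hNW.exists_notMem
    obtain ⟨ε, hε, hφ⟩ := exists_separated_family f hx hk
    obtain ⟨N, hN⟩ := hbound ε hε
    refine le_trans ?_ (le_iSup₂ (f := fun (ε : ℝ) (_ : 0 < ε) =>
      atTop.limsup fun n : ℕ => ENNReal.ofReal
        (Real.log (maxSep (inducedSym f f.continuous k) univ n ε) / Real.log n)) ε hε)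
    rw [← (tendsto_log_mul_pow_div_log k (c := 1 / (2 ^ k * k.factorial))
      (by positivity)).limsup_eq]
    refine limsup_le_limsup ?_
    filter_upwards [eventually_gt_atTop 1, eventually_ge_atTop (2 * k)] with n hn hnk
    have hn' : (1 : ℝ) < n := by exact_mod_cast hn
    refine ENNReal.ofReal_le_ofReal (div_le_div_of_nonneg_right ?_ (Real.log_pos hn').le)
    refine Real.log_le_log (by positivity) ((Nat.mul_pow_le_choose hnk).trans ?_)
    obtain ⟨φ, hφ⟩ := hφ n
    have := card_le_maxSep hε φ hφ (hN n)
    rw [Fintype.card_coe, Finset.card_powersetCard, Finset.card_range] at this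
    exact_mod_cast this
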